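/- arXiv:1408.5475 — 2 statements merged into one kernel-verified Lean document; each statement's English description precedes it below -/
import Mathlib

section
/- Let I be a monomial ideal in a polynomial ring generated in degree d, with minimal monomial generating set G(I). Define the graph G_I on vertex set G(I) where {u,v} is an edge iff deg(lcm(u,v)) = d+1, and for u,v in G(I) let G_I^{(u,v)} be the induced subgraph on those generators w dividing lcm(u,v). Then I is linearly related (i.e. its first syzygies are linear) if and only if G_I^{(u,v)} is connected for all u, v in G(I). -/
open MvPolynomial

noncomputable section

abbrev SRing (K : Type) [Field K] (n : ℕ) := MvPolynomial (Fin n) K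

/-- total degree of an exponent vector -/
def mdeg {n : ℕ} (e : Fin n →₀ ℕ) : ℕ := e.sum fun _ v => v

/-- minimal monomial generators of a monomial ideal, as exponent vectors:
monomials in `J` none of whose proper divisors lies in `J` -/
def minGen {K : Type} [Field K] {n : ℕ} (J : Ideal (SRing K n)) : Set (Fin n →₀ ℕ) :=
  {e | (monomial e (1:K)) ∈ J ∧
    ∀ e' : Fin n →₀ ℕ, e' ≤ e → e' ≠ e → (monomial e' (1:K)) ∉ J}

/-- adjacency in the graph `G_J^{(u,v)}` : vertices are the minimal generators of `J`
dividing `lcm(u,v)`, with an edge between two of them iff their lcm has degree `d+1` -/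
def lcmGraphAdj {K : Type} [Field K] {n : ℕ} (J : Ideal (SRing K n)) (d : ℕ)
    (u v : Fin n →₀ ℕ) (w w' : Fin n →₀ ℕ) : Prop :=
  w ∈ minGen J ∧ w' ∈ minGen J ∧ w ≤ u ⊔ v ∧ w' ≤ u ⊔ v ∧ mdeg (w ⊔ w') = d + 1

/-- a graded partial free resolution of the ideal `I`, exact at homological positions `< r`:
`F_i` is free with basis in (internal) degrees `dg i`, the maps are graded of degree `0`,
`F_0` surjects onto `I`, and the sequence is exact at `F_i` for `i < r`. -/
structure GradedPartialRes {K : Type} [Field K] {n : ℕ} (I : Ideal (SRing K n)) (r : ℕ∞) where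
  s : ℕ → ℕ
  dg : ∀ i, Fin (s i) → ℕ
  aug : (Fin (s 0) →₀ SRing K n) →ₗ[SRing K n] SRing K n
  diff : ∀ i, (Fin (s (i+1)) →₀ SRing K n) →ₗ[SRing K n] (Fin (s i) →₀ SRing K n)
  aug_hom : ∀ k, (aug (Finsupp.single k 1)).IsHomogeneous (dg 0 k)
  diff_hom : ∀ i k l, (diff i (Finsupp.single k 1)) l = 0 ∨
      ∃ m, ((diff i (Finsupp.single k 1)) l).IsHomogeneous m ∧ dg i l + m = dg (i+1) k
  aug_range : LinearMap.range aug = I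
  exact_zero : (0 : ℕ∞) < r → LinearMap.range (diff 0) = LinearMap.ker aug
  exact_succ : ∀ i : ℕ, ((i : ℕ∞) + 1) < r →
      LinearMap.range (diff (i+1)) = LinearMap.ker (diff i)

/-- the graded Betti number `β_{i,j}(I)`: the minimal number of degree-`j` basis elements
in homological position `i`, over all graded partial resolutions of `I` exact at
positions `0, …, i` (the minimum is attained by the minimal graded free resolution). -/
def gradedBetti {K : Type} [Field K] {n : ℕ} (I : Ideal (SRing K n)) (i j : ℕ) : ℕ∞ :=
  ⨅ R : GradedPartialRes I ((i : ℕ∞)+1),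
    ((Finset.univ.filter fun k => R.dg i k = j).card : ℕ∞)

/-- `I` (generated in degree `d`) is `r` steps linear: `β_{i,i+j}(I) = 0` for
all `i ≤ r` and `j > d` -/
def stepsLinear {K : Type} [Field K] {n : ℕ} (I : Ideal (SRing K n)) (d r : ℕ) : Prop :=
  ∀ i ≤ r, ∀ j, d < j → gradedBetti I i (i+j) = 0

/-- `index(I) = sup{r : I is r steps linear} + 1` -/
def idealIndex {K : Type} [Field K] {n : ℕ} (I : Ideal (SRing K n)) (d : ℕ) : ℕ∞ :=
  sSup {x : ℕ∞ | ∃ r : ℕ, x = (r : ℕ∞) + 1 ∧ stepsLinear I d r}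

/-- `I` is linearly related: all first syzygies are linear, i.e. `index(I) > 1` -/
def LinearlyRelated {K : Type} [Field K] {n : ℕ} (I : Ideal (SRing K n)) (d : ℕ) : Prop :=
  stepsLinear I d 1

/-- projective dimension of `I`: the minimal length of a graded free resolution of `I` -/
def projDim {K : Type} [Field K] {n : ℕ} (I : Ideal (SRing K n)) : ℕ∞ :=
  sInf {x : ℕ∞ | ∃ m : ℕ, x = (m : ℕ∞) ∧
    ∃ R : GradedPartialRes I ⊤, ∀ i : ℕ, m < i → R.s i = 0}

/-- the edge ideal of the graph (possibly with loops) given by a symmetric relation `E`: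
generated by the monomials `X i * X j` with `E i j` -/
def edgeIdeal (K : Type) [Field K] {n : ℕ} (E : Fin n → Fin n → Prop) : Ideal (SRing K n) :=
  Ideal.span {p | ∃ i j, E i j ∧ p = X i * X j}

/-- `E` is gap free: for any two disjoint edges there is an edge meeting both -/
def GapFree {n : ℕ} (E : Fin n → Fin n → Prop) : Prop :=
  ∀ i i' j j', E i i' → E j j' → i ≠ j → i ≠ j' → i' ≠ j → i' ≠ j' →
    ∃ a b, E a b ∧ (a = i ∨ a = i') ∧ (b = j ∨ b = j')

/-- the `S`-linear map from the free module on `ι` sending the `i`-th basis vector to the term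
with exponent `g i` and coefficient `c i` -/
def termMap {K : Type} [Field K] {n : ℕ} {ι : Type} (g : ι → Fin n →₀ ℕ) (c : ι → K) :
    (ι →₀ SRing K n) →ₗ[SRing K n] SRing K n :=
  Finsupp.linearCombination (SRing K n) fun i => monomial (g i) (c i)

open Classical in
/-- a `K`-linear section of `termMap g 1` on the ideal generated by the monomials `g i`: a monomial
divisible by some `g i` goes to a multiple of one such basis vector, all others go to zero -/
def termLift (K : Type) [Field K] {n : ℕ} {ι : Type} (g : ι → Fin n →₀ ℕ) :
    SRing K n →ₗ[K] (ι →₀ SRing K n) :=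
  (basisMonomials (Fin n) K).constr K fun e =>
    if h : ∃ i, g i ≤ e then Finsupp.single h.choose (monomial (e - g h.choose) 1) else 0

section terms

variable {K : Type} [Field K] {n : ℕ} {ι : Type} (g : ι → Fin n →₀ ℕ)

theorem termMap_single (c : ι → K) (i : ι) (p : SRing K n) :
    termMap g c (Finsupp.single i p) = p * monomial (g i) (c i) := by
  simp [termMap]

theorem termMap_single_monomial_sub (c : ι → K) {i : ι} {e : Fin n →₀ ℕ} (h : g i ≤ e) :
    termMap g c (Finsupp.single i (monomial (e - g i) 1)) = monomial e (c i) := by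
  rw [termMap_single, monomial_mul, tsub_add_cancel_of_le h, one_mul]

theorem coeff_termMap (c : ι → K) (q : ι →₀ SRing K n) (b : Fin n →₀ ℕ) :
    coeff b (termMap g c q) =
      ∑ i ∈ q.support, if g i ≤ b then coeff (b - g i) (q i) * c i else 0 := by
  simp only [termMap, Finsupp.linearCombination_apply, Finsupp.sum, coeff_sum, smul_eq_mul,
    coeff_mul_monomial']

/-- If the weights agree on all generators dividing `x ^ b`, a syzygy maps to zero in
multidegree `b`. -/
theorem coeff_termMap_eq_zero {c : ι → K} {q : ι →₀ SRing K n} {b : Fin n →₀ ℕ}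
    (hq : termMap g 1 q = 0) (hc : ∀ i j, g i ≤ b → g j ≤ b → c i = c j) :
    coeff b (termMap g c q) = 0 := by
  by_cases h : ∃ i, g i ≤ b
  · obtain ⟨i, hi⟩ := h
    have h0 : coeff b (termMap g 1 q) * c i = 0 := by simp [hq]
    rw [← h0, coeff_termMap, coeff_termMap, Finset.sum_mul]
    refine Finset.sum_congr rfl fun j _ => ?_
    split_ifs with hj
    · simp [hc j i hj hi]
    · simp
  · push Not at h
    rw [coeff_termMap]
    exact Finset.sum_eq_zero fun i _ => if_neg (h i)

theorem coeff_termMap_smul {c : ι → K} {q : ι →₀ SRing K n} {a : Fin n →₀ ℕ}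
    (hq : termMap g 1 q = 0)
    (hc : ∀ b ≤ a, b ≠ a → ∀ i j, g i ≤ b → g j ≤ b → c i = c j) (p : SRing K n) :
    coeff a (termMap g c (p • q)) = coeff 0 p * coeff a (termMap g c q) := by
  classical
  rw [map_smul, smul_eq_mul, coeff_mul]
  refine Finset.sum_eq_single (0, a) (fun x hx hne => ?_) (fun h => absurd (by simp) h)
  rw [Finset.HasAntidiagonal.mem_antidiagonal] at hx
  have hx2 : x.2 ≠ a := by
    rintro h
    apply hne
    rw [h] at hx
    exact Prod.ext (by simpa using hx) h
  rw [coeff_termMap_eq_zero g hq (hc x.2 (hx ▸ le_add_self) hx2), mul_zero]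

theorem termLift_monomial (e : Fin n →₀ ℕ) :
    (∃ i, g i ≤ e ∧ termLift K g (monomial e 1) = Finsupp.single i (monomial (e - g i) 1)) ∨
      (∀ i, ¬ g i ≤ e) ∧ termLift K g (monomial e 1) = 0 := by
  classical
  have h : termLift K g (monomial e 1) = if h : ∃ i, g i ≤ e then
      Finsupp.single h.choose (monomial (e - g h.choose) 1) else 0 :=
    (basisMonomials (Fin n) K).constr_basis K _ e
  by_cases he : ∃ i, g i ≤ e
  · exact .inl ⟨he.choose, he.choose_spec, by rw [h, dif_pos he]⟩
  · exact .inr ⟨by simpa using he, by rw [h, dif_neg he]⟩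

theorem eq_sum_smul_monomial (f : SRing K n) :
    f = ∑ e ∈ f.support, coeff e f • monomial e (1 : K) := by
  conv_lhs => rw [f.as_sum]
  simp [smul_monomial]

theorem termMap_termLift {f : SRing K n}
    (hf : f ∈ Ideal.span ((fun e => monomial e (1 : K)) '' Set.range g)) :
    termMap g 1 (termLift K g f) = f := by
  rw [mem_ideal_span_monomial_image] at hf
  conv_rhs => rw [eq_sum_smul_monomial f]
  conv_lhs => rw [eq_sum_smul_monomial f]
  rw [map_sum, map_sum]
  refine Finset.sum_congr rfl fun e he => ?_
  rw [map_smul, LinearMap.map_smul_of_tower]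
  congr 1
  obtain ⟨_, ⟨i, rfl⟩, hi⟩ := hf e he
  obtain ⟨j, hj, h⟩ | ⟨h, -⟩ := termLift_monomial (K := K) g e
  · rw [h, termMap_single_monomial_sub g _ hj, Pi.one_apply]
  · exact absurd hi (h i)

theorem isHomogeneous_termMap_termLift (c : ι → K) {f : SRing K n} {m : ℕ}
    (hf : f.IsHomogeneous m) : (termMap g c (termLift K g f)).IsHomogeneous m := by
  rw [eq_sum_smul_monomial f, map_sum, map_sum]
  refine IsHomogeneous.sum _ _ _ fun e he => ?_
  rw [map_smul, LinearMap.map_smul_of_tower, smul_eq_C_mul]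
  refine IsHomogeneous.C_mul ?_ _
  have hd : e.degree = m := by
    by_contra h
    exact mem_support_iff.mp he (hf.coeff_eq_zero h)
  obtain ⟨j, hj, h⟩ | ⟨-, h⟩ := termLift_monomial (K := K) g e
  · rw [h, termMap_single_monomial_sub g _ hj]
    exact isHomogeneous_monomial _ hd
  · rw [h, map_zero]
    exact isHomogeneous_zero _ _ _

/-- A submodule of syzygies is everything as soon as it contains all pair syzygies. -/
theorem ker_termMap_le {N : Submodule (SRing K n) (ι →₀ SRing K n)}
    (hN : ∀ a i j, g i ≤ a → g j ≤ a →
      Finsupp.single i (monomial (a - g i) (1 : K)) - Finsupp.single j (monomial (a - g j) 1) ∈ N) :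
    LinearMap.ker (termMap g (1 : ι → K)) ≤ N := by
  have key : N.mkQ.restrictScalars K ∘ₗ termLift K g ∘ₗ (termMap g 1).restrictScalars K =
      N.mkQ.restrictScalars K := by
    refine Finsupp.lhom_ext' fun i => (basisMonomials (Fin n) K).ext fun e => ?_
    have h1 : termMap g (1 : ι → K) (Finsupp.single i (monomial e 1)) = monomial (e + g i) 1 := by
      simp [termMap_single, monomial_mul]
    simp only [coe_basisMonomials, LinearMap.comp_apply, LinearMap.restrictScalars_apply,
      Finsupp.lsingle_apply, h1]
    obtain ⟨j, hj, h⟩ | ⟨h, -⟩ := termLift_monomial (K := K) g (e + g i)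
    · rw [h, Submodule.mkQ_apply, Submodule.mkQ_apply, Submodule.Quotient.eq]
      simpa using hN (e + g i) j i hj le_add_self
    · exact absurd le_add_self (h i)
  intro z hz
  have := LinearMap.congr_fun key z
  simp only [LinearMap.comp_apply, LinearMap.restrictScalars_apply, LinearMap.mem_ker.mp hz,
    map_zero] at this
  exact (Submodule.Quotient.mk_eq_zero N).mp this.symm

end terms

section gradedKernel

variable {K : Type} [Field K] {n s t : ℕ}

/-- the degree-`j` component of an element of the graded free module whose basis vectors have
degrees `dg` -/
def degreeComponent (K : Type) [Field K] (n : ℕ) {s : ℕ} (dg : Fin s → ℕ) (j : ℕ) :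
    (Fin s →₀ SRing K n) →ₗ[K] (Fin s →₀ SRing K n) :=
  Finsupp.lsum K fun l =>
    if dg l ≤ j then Finsupp.lsingle l ∘ₗ homogeneousComponent (j - dg l) else 0

theorem coeff_degreeComponent (dg : Fin s → ℕ) (j : ℕ) (z : Fin s →₀ SRing K n) (l : Fin s)
    (e : Fin n →₀ ℕ) :
    coeff e (degreeComponent K n dg j z l) = if dg l + e.degree = j then coeff e (z l) else 0 := by
  classical
  have h : degreeComponent K n dg j z l =
      if dg l ≤ j then homogeneousComponent (j - dg l) (z l) else 0 := by
    rw [degreeComponent, Finsupp.lsum_apply, Finsupp.sum_fintype _ _ (by simp),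
      Finsupp.finsetSum_apply, Finset.sum_eq_single l]
    · split_ifs <;> simp
    · intro k _ hk
      split_ifs <;> simp [hk]
    · simp
  rw [h]
  split_ifs with h1 h2 h2
  · rw [coeff_homogeneousComponent, if_pos (by omega)]
  · rw [coeff_homogeneousComponent, if_neg (by omega)]
  · omega
  · simp

theorem degreeComponent_isHomogeneous (dg : Fin s → ℕ) (j : ℕ) (z : Fin s →₀ SRing K n)
    (l : Fin s) : degreeComponent K n dg j z l = 0 ∨
      ∃ m, (degreeComponent K n dg j z l).IsHomogeneous m ∧ dg l + m = j := by
  by_cases h : dg l ≤ j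
  · refine .inr ⟨j - dg l, fun e he => ?_, by omega⟩
    rw [coeff_degreeComponent] at he
    have := (ite_ne_right_iff.mp he).1
    have hw : Finsupp.weight 1 e = e.degree := by rw [Finsupp.degree_eq_weight_one]; rfl
    omega
  · left
    ext e
    rw [coeff_degreeComponent, if_neg (by omega), coeff_zero]

theorem exists_sum_degreeComponent (dg : Fin s → ℕ) (z : Fin s →₀ SRing K n) :
    ∃ N, ∑ j ∈ Finset.range N, degreeComponent K n dg j z = z := by
  refine ⟨∑ l, (dg l + (z l).totalDegree) + 1, ?_⟩
  ext l e
  simp only [Finsupp.finsetSum_apply, coeff_sum, coeff_degreeComponent]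
  rw [Finset.sum_ite_eq]
  split_ifs with h
  · rfl
  · symm
    by_contra hne
    apply h
    have h1 := le_totalDegree (mem_support_iff.mpr hne)
    have h2 : dg l + (z l).totalDegree ≤ ∑ l, (dg l + (z l).totalDegree) :=
      Finset.single_le_sum (f := fun l => dg l + (z l).totalDegree) (fun _ _ => Nat.zero_le _)
        (Finset.mem_univ l)
    rw [Finset.mem_range]
    have h3 : e.degree = e.sum fun _ v => v := rfl
    omega

theorem map_degreeComponent {dg : Fin s → ℕ} {dg' : Fin t → ℕ}
    {φ : (Fin s →₀ SRing K n) →ₗ[SRing K n] (Fin t →₀ SRing K n)}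
    (hφ : ∀ k l, φ (Finsupp.single k 1) l = 0 ∨
      ∃ m, (φ (Finsupp.single k 1) l).IsHomogeneous m ∧ dg' l + m = dg k)
    (j : ℕ) (z : Fin s →₀ SRing K n) :
    φ (degreeComponent K n dg j z) = degreeComponent K n dg' j (φ z) := by
  have key : φ.restrictScalars K ∘ₗ degreeComponent K n dg j =
      degreeComponent K n dg' j ∘ₗ φ.restrictScalars K := by
    refine Finsupp.lhom_ext' fun k => (basisMonomials (Fin n) K).ext fun e => ?_
    simp only [coe_basisMonomials, LinearMap.comp_apply, LinearMap.restrictScalars_apply,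
      Finsupp.lsingle_apply]
    have h1 : degreeComponent K n dg j (Finsupp.single k (monomial e 1)) =
        if dg k + e.degree = j then Finsupp.single k (monomial e 1) else 0 := by
      ext l b
      rw [coeff_degreeComponent]
      by_cases hl : k = l
      · subst hl
        by_cases hb : e = b
        · subst hb
          split_ifs <;> simp
        · split_ifs <;> simp [coeff_monomial, hb]
      · split_ifs <;> simp [hl]
    have h2 : φ (Finsupp.single k (monomial e 1)) =
        monomial e (1 : K) • φ (Finsupp.single k 1) := by
      rw [← map_smul, Finsupp.smul_single, smul_eq_mul, mul_one]
    ext l b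
    rw [h1, apply_ite φ, map_zero, h2, coeff_degreeComponent, Finsupp.smul_apply, smul_eq_mul]
    obtain h0 | ⟨m, hm, hd⟩ := hφ k l
    · split_ifs <;> simp [h0]
    · have hhom : (monomial e (1 : K) * φ (Finsupp.single k 1) l).IsHomogeneous (e.degree + m) :=
        (isHomogeneous_monomial _ rfl).mul hm
      by_cases hb : b.degree = e.degree + m
      · by_cases hj : dg k + e.degree = j
        · rw [if_pos hj, if_pos (by omega), Finsupp.smul_apply, smul_eq_mul]
        · rw [if_neg hj, if_neg (by omega)]
          simp
      · have h0 := hhom.coeff_eq_zero hb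
        rw [h0]
        split_ifs <;> simp [h0]
  exact LinearMap.congr_fun key z

/-- The kernel of a graded map between finite graded free modules is the range of another. -/
theorem exists_graded_range_eq_ker {dg : Fin s → ℕ} {dg' : Fin t → ℕ}
    {φ : (Fin s →₀ SRing K n) →ₗ[SRing K n] (Fin t →₀ SRing K n)}
    (hφ : ∀ k l, φ (Finsupp.single k 1) l = 0 ∨
      ∃ m, (φ (Finsupp.single k 1) l).IsHomogeneous m ∧ dg' l + m = dg k) :
    ∃ (r : ℕ) (dg'' : Fin r → ℕ) (ψ : (Fin r →₀ SRing K n) →ₗ[SRing K n] (Fin s →₀ SRing K n)),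
      (∀ k l, ψ (Finsupp.single k 1) l = 0 ∨
        ∃ m, (ψ (Finsupp.single k 1) l).IsHomogeneous m ∧ dg l + m = dg'' k) ∧
      LinearMap.range ψ = LinearMap.ker φ := by
  set H : Set (Fin s →₀ SRing K n) :=
    {z | φ z = 0 ∧ ∃ j, ∀ l, z l = 0 ∨ ∃ m, (z l).IsHomogeneous m ∧ dg l + m = j} with hH
  have hspan : Submodule.span (SRing K n) H = LinearMap.ker φ := by
    refine le_antisymm (Submodule.span_le.mpr fun z hz => hz.1) fun z hz => ?_
    obtain ⟨N, hN⟩ := exists_sum_degreeComponent dg z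
    rw [← hN]
    refine Submodule.sum_mem _ fun j _ => Submodule.subset_span ⟨?_, j, ?_⟩
    · rw [map_degreeComponent hφ, LinearMap.mem_ker.mp hz, map_zero]
    · exact degreeComponent_isHomogeneous dg j z
  obtain ⟨T, hTH, hT⟩ := (Submodule.fg_span_iff_fg_span_finset_subset H).mp
    (IsNoetherian.noetherian (R := SRing K n) _)
  obtain ⟨r, f, -, hf⟩ := T.finite_toSet.fin_param
  have hfH : ∀ k, f k ∈ H := fun k => hTH (hf ▸ Set.mem_range_self k)
  choose dg'' hdg'' using fun k => (hfH k).2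
  refine ⟨r, dg'', Finsupp.linearCombination _ f, fun k l => ?_, ?_⟩
  · simpa using hdg'' k l
  · rw [Finsupp.range_linearCombination, hf, ← hT, hspan]

/-- A graded presentation of an ideal extends to a graded partial resolution exact at the first
two positions. -/
theorem exists_gradedPartialRes {I : Ideal (SRing K n)} {dg₀ : Fin t → ℕ} {dg₁ : Fin s → ℕ}
    {ε : (Fin t →₀ SRing K n) →ₗ[SRing K n] SRing K n}
    {φ : (Fin s →₀ SRing K n) →ₗ[SRing K n] (Fin t →₀ SRing K n)}
    (hε : ∀ k, (ε (Finsupp.single k 1)).IsHomogeneous (dg₀ k))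
    (hφ : ∀ k l, φ (Finsupp.single k 1) l = 0 ∨
      ∃ m, (φ (Finsupp.single k 1) l).IsHomogeneous m ∧ dg₀ l + m = dg₁ k)
    (hI : LinearMap.range ε = I) (hex : LinearMap.range φ = LinearMap.ker ε)
    {r : ℕ∞} (hr : r ≤ 2) :
    ∃ R : GradedPartialRes I r,
      (∀ k, ∃ k', R.dg 0 k = dg₀ k') ∧ ∀ k, ∃ k', R.dg 1 k = dg₁ k' := by
  obtain ⟨q, dg₂, ψ, hψ, hψφ⟩ := exists_graded_range_eq_ker hφ
  let s' : ℕ → ℕ := fun | 0 => t | 1 => s | 2 => q | _ + 3 => 0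
  let dg : ∀ i, Fin (s' i) → ℕ := fun
    | 0 => dg₀
    | 1 => dg₁
    | 2 => dg₂
    | _ + 3 => fun _ => 0
  let diff : ∀ i, (Fin (s' (i + 1)) →₀ SRing K n) →ₗ[SRing K n] (Fin (s' i) →₀ SRing K n) := fun
    | 0 => φ
    | 1 => ψ
    | _ + 2 => 0
  exact ⟨{
    s := s'
    dg := dg
    aug := ε
    diff := diff
    aug_hom := hε
    diff_hom := fun
      | 0 => hφ
      | 1 => hψ
      | _ + 2 => fun _ _ => .inl rfl
    aug_range := hI
    exact_zero := fun _ => hex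
    exact_succ := fun
      | 0 => fun _ => hψφ
      | i + 1 => fun h => by
        have h2 : (((i + 1 : ℕ) : ℕ∞) + 1) < 2 := h.trans_le hr
        norm_cast at h2 }, fun k => ⟨k, rfl⟩, fun k => ⟨k, rfl⟩⟩

end gradedKernel

section criterion

variable {K : Type} [Field K] {n d : ℕ} {ι : Type} {g : ι → Fin n →₀ ℕ}
  {I : Ideal (SRing K n)}

theorem coeff_termMap_monomial_smul {c : ι → K} {a : Fin n →₀ ℕ}
    (hc : ∀ b ≤ a, b ≠ a → ∀ i j, g i ≤ b → g j ≤ b → c i = c j) {i : ι} (hi : g i ≤ a)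
    (hia : g i ≠ a) {q : ι →₀ SRing K n} (hq : termMap g 1 q = monomial (g i) 1) :
    coeff a (termMap g c (monomial (a - g i) (1 : K) • q)) = c i := by
  have h0 : termMap g 1 (q - Finsupp.single i 1) = 0 := by
    rw [map_sub, hq, termMap_single, one_mul, Pi.one_apply, sub_self]
  have h1 := coeff_termMap_smul g h0 hc (monomial (a - g i) 1)
  have h2 : a - g i ≠ 0 := fun h => hia (le_antisymm hi (tsub_eq_zero_iff_le.mp h))
  rw [coeff_monomial, if_neg h2, zero_mul, smul_sub, map_sub, coeff_sub, sub_eq_zero,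
    Finsupp.smul_single, smul_eq_mul, mul_one, termMap_single_monomial_sub g _ hi,
    coeff_monomial, if_pos rfl] at h1
  exact h1

/-- A partial resolution without first syzygies in the degree of `x ^ a` leaves no room for a
pair syzygy in multidegree `a` that is not generated in smaller multidegrees. -/
theorem weight_eq_of_gradedPartialRes {r : ℕ∞} (R : GradedPartialRes I r) (hr : 0 < r)
    (hI : I = Ideal.span ((fun e => monomial e (1 : K)) '' Set.range g))
    {c : ι → K} {a : Fin n →₀ ℕ} (hR : ∀ k, R.dg 1 k ≠ a.degree)
    (hc : ∀ b ≤ a, b ≠ a → ∀ i j, g i ≤ b → g j ≤ b → c i = c j)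
    {i j : ι} (hi : g i ≤ a) (hia : g i ≠ a) (hj : g j ≤ a) (hja : g j ≠ a) : c i = c j := by
  set β : (Fin (R.s 0) →₀ SRing K n) →ₗ[SRing K n] (ι →₀ SRing K n) :=
    Finsupp.linearCombination _ fun k => termLift K g (R.aug (Finsupp.single k 1)) with hβ
  have hmem : ∀ x, R.aug x ∈ I := fun x => (SetLike.ext_iff.mp R.aug_range _).mp ⟨x, rfl⟩
  have hβaug : ∀ x, termMap g 1 (β x) = R.aug x := by
    suffices termMap g 1 ∘ₗ β = R.aug from LinearMap.congr_fun this
    refine Finsupp.lhom_ext' fun k => LinearMap.ext_ring ?_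
    simp only [LinearMap.comp_apply, Finsupp.lsingle_apply, hβ,
      Finsupp.linearCombination_single, one_smul]
    exact termMap_termLift g (hI ▸ hmem _)
  have hgen : ∀ k, ∃ x, R.aug x = monomial (g k) 1 := fun k => by
    have : monomial (g k) (1 : K) ∈ I := hI ▸ Ideal.subset_span ⟨g k, ⟨k, rfl⟩, rfl⟩
    rwa [← R.aug_range] at this
  obtain ⟨x, hx⟩ := hgen i
  obtain ⟨x', hx'⟩ := hgen j
  have hker : monomial (a - g i) (1 : K) • x - monomial (a - g j) (1 : K) • x' ∈
      LinearMap.ker R.aug := by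
    rw [LinearMap.mem_ker, map_sub, map_smul, map_smul, hx, hx', smul_eq_mul, smul_eq_mul,
      monomial_mul, monomial_mul, tsub_add_cancel_of_le hi, tsub_add_cancel_of_le hj, sub_self]
  rw [← R.exact_zero hr] at hker
  obtain ⟨y, hy⟩ := hker
  have hleft : coeff a (termMap g c (β (R.diff 0 y))) = c i - c j := by
    rw [hy, map_sub, map_smul, map_smul, map_sub, coeff_sub,
      coeff_termMap_monomial_smul hc hi hia ((hβaug x).trans hx),
      coeff_termMap_monomial_smul hc hj hja ((hβaug x').trans hx')]
  have hbasis : ∀ k, coeff a (termMap g c (β (R.diff 0 (Finsupp.single k 1)))) = 0 := fun k => by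
    refine IsHomogeneous.coeff_eq_zero (n := R.dg 1 k) ?_ (hR k).symm
    rw [hβ, Finsupp.linearCombination_apply, Finsupp.sum, map_sum]
    refine IsHomogeneous.sum _ _ _ fun l _ => ?_
    rw [map_smul, smul_eq_mul]
    obtain h | ⟨m, hm, hd⟩ := R.diff_hom 0 k l
    · rw [h, zero_mul]
      exact isHomogeneous_zero _ _ _
    · have := hm.mul (isHomogeneous_termMap_termLift g c (R.aug_hom l))
      have hd' : m + R.dg 0 l = R.dg 1 k := (add_comm _ _).trans hd
      rwa [hd'] at this
  have hright : coeff a (termMap g c (β (R.diff 0 y))) = 0 := by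
    have hsyz : ∀ k, termMap g 1 (β (R.diff 0 (Finsupp.single k 1))) = 0 := fun k => by
      rw [hβaug, ← LinearMap.mem_ker, ← R.exact_zero hr]
      exact LinearMap.mem_range_self _ _
    have hy : y = ∑ k ∈ y.support, y k • Finsupp.single k (1 : SRing K n) := by
      conv_lhs => rw [← y.sum_single]
      simp [Finsupp.sum]
    rw [hy]
    simp only [map_sum, map_smul, coeff_sum]
    refine Finset.sum_eq_zero fun k _ => ?_
    rw [← map_smul, coeff_termMap_smul g (hsyz k) hc, hbasis, mul_zero]
  exact sub_eq_zero.mp (hleft.symm.trans hright)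

theorem gradedBetti_eq_zero_iff {i j : ℕ} :
    gradedBetti I i j = 0 ↔ ∃ R : GradedPartialRes I ((i : ℕ∞) + 1), ∀ k, R.dg i k ≠ j := by
  simp [gradedBetti, ENat.iInf_eq_zero, Finset.filter_eq_empty_iff]

theorem reflTransGen_lcmGraphAdj_mono {u v u' v' w w' : Fin n →₀ ℕ} (h : u ⊔ v ≤ u' ⊔ v')
    (hw : Relation.ReflTransGen (lcmGraphAdj I d u v) w w') :
    Relation.ReflTransGen (lcmGraphAdj I d u' v') w w' :=
  Relation.ReflTransGen.mono
    (fun _ _ ⟨h1, h2, h3, h4, h5⟩ => ⟨h1, h2, h3.trans h, h4.trans h, h5⟩) _ _ hw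

theorem eq_of_le_of_degree_le {e f : Fin n →₀ ℕ} (h : e ≤ f) (hd : f.degree ≤ e.degree) :
    e = f := by
  have h1 : (f - e).degree + e.degree = f.degree := by
    rw [← map_add, tsub_add_cancel_of_le h]
  have h2 : f - e = 0 := Finsupp.degree_eq_zero_iff _ |>.mp (by omega)
  exact le_antisymm h (tsub_eq_zero_iff_le.mp h2)

theorem connected_of_linearlyRelated
    (hgen : I = Ideal.span ((fun e => (monomial e (1 : K))) '' minGen I))
    (hdeg : ∀ e ∈ minGen I, e.degree = d) (hlin : LinearlyRelated I d)
    {u v : Fin n →₀ ℕ} (hu : u ∈ minGen I) (hv : v ∈ minGen I) :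
    Relation.ReflTransGen (lcmGraphAdj I d u v) u v := by
  classical
  induction hm : (u ⊔ v).degree using Nat.strong_induction_on generalizing u v with
  | h m ih =>
  have hdu := hdeg u hu
  have hdv := hdeg v hv
  have hle : d ≤ m := hdu ▸ hm ▸ Finsupp.degree_mono (le_sup_left (a := u) (b := v))
  obtain rfl | rfl | hlt : m = d ∨ m = d + 1 ∨ d + 1 < m := by omega
  · rw [eq_of_le_of_degree_le (le_sup_left (a := u) (b := v)) (by omega),
      ← eq_of_le_of_degree_le (le_sup_right (a := u) (b := v)) (by omega)]
  · exact .single ⟨hu, hv, le_sup_left, le_sup_right, hm⟩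
  · obtain ⟨R, hR⟩ := gradedBetti_eq_zero_iff.mp (hlin 1 le_rfl (m - 1) (by omega))
    rw [Nat.add_sub_cancel' (by omega), ← hm] at hR
    have hlow : ∀ b ≤ u ⊔ v, b ≠ u ⊔ v → ∀ w ∈ minGen I, ∀ w' ∈ minGen I, w ≤ b → w' ≤ b →
        Relation.ReflTransGen (lcmGraphAdj I d u v) w w' := by
      intro b hb hbne w hw w' hw' hwb hwb'
      have hlt : (w ⊔ w').degree < m := by
        by_contra hge
        refine hbne (eq_of_le_of_degree_le hb ?_)
        have := Finsupp.degree_mono (sup_le hwb hwb')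
        omega
      exact reflTransGen_lcmGraphAdj_mono ((sup_le hwb hwb').trans hb) (ih _ hlt hw hw' rfl)
    have hne : ∀ w ∈ minGen I, w ≠ u ⊔ v := fun w hw h => by
      have := hdeg w hw
      rw [h] at this
      omega
    have hI : I = Ideal.span ((fun e => monomial e (1 : K)) ''
        Set.range (Subtype.val : minGen I → Fin n →₀ ℕ)) := by
      rwa [Subtype.range_coe]
    have key := weight_eq_of_gradedPartialRes R (by simp) hI
      (c := fun w => if Relation.ReflTransGen (lcmGraphAdj I d u v) u w then 1 else 0)
      (a := u ⊔ v) hR (fun b hb hbne i j hib hjb => by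
        have : Relation.ReflTransGen (lcmGraphAdj I d u v) u i ↔
            Relation.ReflTransGen (lcmGraphAdj I d u v) u j :=
          ⟨fun h => h.trans (hlow b hb hbne i i.2 j j.2 hib hjb),
            fun h => h.trans (hlow b hb hbne j j.2 i i.2 hjb hib)⟩
        simp only [this])
      (i := ⟨u, hu⟩) (j := ⟨v, hv⟩) le_sup_left (hne u hu) le_sup_right (hne v hv)
    by_contra hcon
    simp [Relation.ReflTransGen.refl, hcon] at key

/-- the syzygy between two generators in multidegree `a` -/
def pairSyzygy (K : Type) [Field K] (g : ι → Fin n →₀ ℕ) (a : Fin n →₀ ℕ) (i j : ι) :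
    ι →₀ SRing K n :=
  Finsupp.single i (monomial (a - g i) 1) - Finsupp.single j (monomial (a - g j) 1)

theorem termMap_pairSyzygy {a : Fin n →₀ ℕ} {i j : ι} (hi : g i ≤ a) (hj : g j ≤ a) :
    termMap g 1 (pairSyzygy K g a i j) = 0 := by
  rw [pairSyzygy, map_sub, termMap_single_monomial_sub g _ hi, termMap_single_monomial_sub g _ hj,
    Pi.one_apply, Pi.one_apply, sub_self]

theorem monomial_smul_pairSyzygy {a b : Fin n →₀ ℕ} {i j : ι} (hi : g i ≤ b) (hj : g j ≤ b)
    (hb : b ≤ a) :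
    monomial (a - b) (1 : K) • pairSyzygy K g b i j = pairSyzygy K g a i j := by
  simp only [pairSyzygy, smul_sub, Finsupp.smul_single, smul_eq_mul, monomial_mul, one_mul,
    tsub_add_tsub_cancel hb hi, tsub_add_tsub_cancel hb hj]

theorem pairSyzygy_add (a : Fin n →₀ ℕ) (i j k : ι) :
    pairSyzygy K g a i j + pairSyzygy K g a j k = pairSyzygy K g a i k :=
  sub_add_sub_cancel _ _ _

theorem pairSyzygy_mem_of_reflTransGen (hg : Function.Injective g) (hrange : Set.range g = minGen I)
    {N : Submodule (SRing K n) (ι →₀ SRing K n)}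
    (hN : ∀ i j, (g i ⊔ g j).degree = d + 1 → pairSyzygy K g (g i ⊔ g j) i j ∈ N)
    {u v a : Fin n →₀ ℕ} (ha : u ⊔ v ≤ a) {i j : ι}
    (h : Relation.ReflTransGen (lcmGraphAdj I d u v) (g i) (g j)) : pairSyzygy K g a i j ∈ N := by
  generalize hw : g j = w at h
  induction h generalizing j with
  | refl =>
    rw [hg hw, pairSyzygy, sub_self]
    exact N.zero_mem
  | @tail w w' _ hadj ih =>
    obtain ⟨h1, -, h3, h4, h5⟩ := hadj
    obtain ⟨k, hk⟩ : w ∈ Set.range g := hrange ▸ h1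
    subst hk hw
    rw [← pairSyzygy_add a i k j, ← monomial_smul_pairSyzygy le_sup_left le_sup_right
      ((sup_le h3 h4).trans ha)]
    exact N.add_mem (ih rfl) (N.smul_mem _ (hN k j h5))

theorem isHomogeneous_pairSyzygy (hd : ∀ i, (g i).degree = d) {i j : ι}
    (hij : (g i ⊔ g j).degree = d + 1) (l : ι) :
    (pairSyzygy K g (g i ⊔ g j) i j l).IsHomogeneous 1 := by
  classical
  have key : ∀ k, g k ≤ g i ⊔ g j →
      (Finsupp.single k (monomial (g i ⊔ g j - g k) (1 : K)) l).IsHomogeneous 1 := fun k hk => by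
    have h1 : (g i ⊔ g j - g k).degree + (g k).degree = (g i ⊔ g j).degree := by
      rw [← map_add, tsub_add_cancel_of_le hk]
    rw [Finsupp.single_apply]
    split_ifs
    · exact isHomogeneous_monomial _ (by have := hd k; omega)
    · exact isHomogeneous_zero _ _ _
  exact (key i le_sup_left).sub (key j le_sup_right)

theorem range_termMap_one :
    LinearMap.range (termMap g (1 : ι → K)) =
      Ideal.span ((fun e => monomial e (1 : K)) '' Set.range g) := by
  rw [termMap, Finsupp.range_linearCombination, ← Set.range_comp]
  rfl

/-- Under the connectedness condition the ideal has a presentation with generators in degree `d`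
and relations in degree `d + 1`. -/
theorem exists_linear_gradedPartialRes
    (hgen : I = Ideal.span ((fun e => (monomial e (1 : K))) '' minGen I))
    (hdeg : ∀ e ∈ minGen I, e.degree = d)
    (hconn : ∀ u ∈ minGen I, ∀ v ∈ minGen I, Relation.ReflTransGen (lcmGraphAdj I d u v) u v)
    {r : ℕ∞} (hr : r ≤ 2) :
    ∃ R : GradedPartialRes I r, (∀ k, R.dg 0 k = d) ∧ ∀ k, R.dg 1 k = d + 1 := by
  have hfin : (minGen I).Finite := (Finsupp.finite_of_degree_eq d).subset hdeg
  obtain ⟨t, g, hg, hrange⟩ := hfin.fin_param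
  have hgmem : ∀ i, g i ∈ minGen I := fun i => hrange ▸ Set.mem_range_self i
  have hd : ∀ i, (g i).degree = d := fun i => hdeg _ (hgmem i)
  obtain ⟨s, f, -, hf⟩ := (Set.toFinite
    {p : Fin t × Fin t | (g p.1 ⊔ g p.2).degree = d + 1}).fin_param
  have hfdeg : ∀ k, (g (f k).1 ⊔ g (f k).2).degree = d + 1 := fun k => by
    have := Set.mem_range_self (f := f) k
    rwa [hf] at this
  set σ : Fin s → Fin t →₀ SRing K n :=
    fun k => pairSyzygy K g (g (f k).1 ⊔ g (f k).2) (f k).1 (f k).2 with hσ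
  obtain ⟨R, h0, h1⟩ := exists_gradedPartialRes (I := I) (dg₀ := fun _ : Fin t => d)
    (dg₁ := fun _ : Fin s => d + 1) (ε := termMap g 1)
    (φ := Finsupp.linearCombination (SRing K n) σ)
    (fun k => by
      rw [termMap_single, one_mul]
      exact isHomogeneous_monomial _ (hd k))
    (fun k l => .inr ⟨1, by simpa using isHomogeneous_pairSyzygy hd (hfdeg k) l, rfl⟩)
    (by rw [range_termMap_one, hrange, ← hgen])
    (by
      rw [Finsupp.range_linearCombination]
      refine le_antisymm (Submodule.span_le.mpr ?_) (ker_termMap_le g fun a i j hi hj => ?_)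
      · rintro _ ⟨k, rfl⟩
        exact termMap_pairSyzygy le_sup_left le_sup_right
      · refine pairSyzygy_mem_of_reflTransGen hg hrange (fun i j hij => ?_) (sup_le hi hj)
          (hconn _ (hgmem i) _ (hgmem j))
        obtain ⟨k, hk⟩ : (i, j) ∈ Set.range f := hf ▸ hij
        exact Submodule.subset_span ⟨k, by simp only [hσ, hk]⟩)
    hr
  exact ⟨R, fun k => (h0 k).elim fun _ h => h, fun k => (h1 k).elim fun _ h => h⟩

end criterion

/-- **Proposition (criterion for linear relations).** A monomial ideal `I` generated in
degree `d` is linearly related iff `G_I^{(u,v)}` is connected for all `u, v ∈ G(I)`. -/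
theorem stmt0 (K : Type) [Field K] (n d : ℕ) (I : Ideal (SRing K n))
    (hgen : I = Ideal.span ((fun e => (monomial e (1:K))) '' minGen I))
    (hdeg : ∀ e ∈ minGen I, mdeg e = d) :
    LinearlyRelated I d ↔
      ∀ u ∈ minGen I, ∀ v ∈ minGen I,
        ∀ w ∈ minGen I, ∀ w' ∈ minGen I, w ≤ u ⊔ v → w' ≤ u ⊔ v →
          Relation.ReflTransGen (lcmGraphAdj I d u v) w w' := by
  have hdeg' : ∀ e ∈ minGen I, e.degree = d := hdeg
  constructor
  · intro hlin u hu v hv w hw w' hw' hwuv hwuv'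
    exact reflTransGen_lcmGraphAdj_mono (sup_le hwuv hwuv')
      (connected_of_linearlyRelated hgen hdeg' hlin hw hw')
  · intro hconn i hi j hj
    obtain ⟨R, h0, h1⟩ := exists_linear_gradedPartialRes hgen hdeg'
      (fun u hu v hv => hconn u hu v hv u hu v hv le_sup_left le_sup_right)
      (r := (i : ℕ∞) + 1) (by norm_cast; omega)
    refine gradedBetti_eq_zero_iff.mpr ⟨R, fun k hk => ?_⟩
    obtain rfl | rfl : i = 0 ∨ i = 1 := by omega
    · have := h0 k
      omega
    · have := h1 k
      omega

end
end

section
/- Let G be a finite graph (possibly with loops) with edge ideal I. If G has a gap, i.e. there exist four distinct vertices i, i', j, j' with {i,i'} and {j,j'} edges of G but none of {i,j}, {i,j'}, {i',j}, {i',j'} an edge of G, then for every k >= 1, the monomials u = (x_i x_{i'})^k and v = (x_j x_{j'})^k are not connected in the graph G_{I^k}^{(u,v)}; consequently I^k is not linearly related for any k >= 1. -/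
open MvPolynomial

noncomputable section

section GradedFree

variable {R σ A : Type*} [CommRing R]

/-- A vector of polynomials is homogeneous of degree `d` when the basis vector `a` has
degree `deg a`. -/
def IsHomogeneousVec (deg : A → ℕ) (d : ℕ) (y : A →₀ MvPolynomial σ R) : Prop :=
  ∀ a, y a = 0 ∨ ∃ m, (y a).IsHomogeneous m ∧ deg a + m = d

theorem IsHomogeneousVec.zero (deg : A → ℕ) (d : ℕ) :
    IsHomogeneousVec deg d (0 : A →₀ MvPolynomial σ R) := fun _ => Or.inl rfl

theorem IsHomogeneousVec.add {deg : A → ℕ} {d : ℕ} {y z : A →₀ MvPolynomial σ R}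
    (hy : IsHomogeneousVec deg d y) (hz : IsHomogeneousVec deg d z) :
    IsHomogeneousVec deg d (y + z) := by
  intro a
  rw [Finsupp.add_apply]
  rcases hy a with h | ⟨m, hm, hd⟩
  · rw [h, zero_add]
    exact hz a
  · rcases hz a with h' | ⟨m', hm', hd'⟩
    · rw [h', add_zero]
      exact Or.inr ⟨m, hm, hd⟩
    · obtain rfl : m = m' := by omega
      exact Or.inr ⟨m, hm.add hm', hd⟩

theorem map_eq_sum_mul (T : (A →₀ MvPolynomial σ R) →ₗ[MvPolynomial σ R] MvPolynomial σ R)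
    (y : A →₀ MvPolynomial σ R) :
    T y = y.sum fun a p => p * T (Finsupp.single a 1) := by
  conv_lhs => rw [← y.sum_single]
  rw [map_finsuppSum]
  refine Finsupp.sum_congr fun a _ => ?_
  rw [← smul_eq_mul, ← map_smul, Finsupp.smul_single, smul_eq_mul, mul_one]

theorem isHomogeneous_map {deg : A → ℕ}
    (T : (A →₀ MvPolynomial σ R) →ₗ[MvPolynomial σ R] MvPolynomial σ R)
    (hT : ∀ a, (T (Finsupp.single a 1)).IsHomogeneous (deg a)) {d : ℕ}
    {y : A →₀ MvPolynomial σ R} (hy : IsHomogeneousVec deg d y) :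
    (T y).IsHomogeneous d := by
  rw [map_eq_sum_mul]
  refine IsHomogeneous.sum _ _ _ fun a _ => ?_
  rcases hy a with h | ⟨m, hm, rfl⟩
  · simpa only [h, zero_mul] using isHomogeneous_zero _ _ _
  · rw [add_comm]
    exact hm.mul (hT a)

theorem exists_isHomogeneousVec_map_eq_homogeneousComponent {deg : A → ℕ}
    (T : (A →₀ MvPolynomial σ R) →ₗ[MvPolynomial σ R] MvPolynomial σ R)
    (hT : ∀ a, (T (Finsupp.single a 1)).IsHomogeneous (deg a)) (d : ℕ)
    (y : A →₀ MvPolynomial σ R) :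
    ∃ z, IsHomogeneousVec deg d z ∧ T z = homogeneousComponent d (T y) := by
  classical
  induction y using Finsupp.induction_linear with
  | zero => exact ⟨0, .zero _ _, by simp⟩
  | add f g hf hg =>
    obtain ⟨f', hf', ef⟩ := hf
    obtain ⟨g', hg', eg⟩ := hg
    exact ⟨f' + g', hf'.add hg', by simp [ef, eg]⟩
  | single a p =>
    induction p using MvPolynomial.induction_on' with
    | add p q hp hq =>
      obtain ⟨f', hf', ef⟩ := hp
      obtain ⟨g', hg', eg⟩ := hq
      exact ⟨f' + g', hf'.add hg', by simp [ef, eg]⟩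
    | monomial e c =>
      have hom : (T (Finsupp.single a (monomial e c))).IsHomogeneous (e.degree + deg a) := by
        rw [map_eq_sum_mul, Finsupp.sum_single_index (zero_mul _)]
        exact (isHomogeneous_monomial c rfl).mul (hT a)
      rw [homogeneousComponent_of_mem hom]
      split_ifs with h
      · refine ⟨Finsupp.single a (monomial e c), fun b => ?_, rfl⟩
        by_cases hb : a = b
        · subst hb
          rw [Finsupp.single_eq_same]
          exact Or.inr ⟨_, isHomogeneous_monomial c rfl, by omega⟩
        · exact Or.inl (Finsupp.single_eq_of_ne (Ne.symm hb))
      · exact ⟨0, .zero _ _, by simp⟩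

theorem exists_isHomogeneousVec_map_eq {deg : A → ℕ}
    (T : (A →₀ MvPolynomial σ R) →ₗ[MvPolynomial σ R] MvPolynomial σ R)
    (hT : ∀ a, (T (Finsupp.single a 1)).IsHomogeneous (deg a)) {d : ℕ}
    {x : MvPolynomial σ R} (hx : x.IsHomogeneous d) (hr : x ∈ LinearMap.range T) :
    ∃ z, IsHomogeneousVec deg d z ∧ T z = x := by
  obtain ⟨y, rfl⟩ := hr
  obtain ⟨z, hz, e⟩ := exists_isHomogeneousVec_map_eq_homogeneousComponent T hT d y
  refine ⟨z, hz, ?_⟩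
  rw [e, homogeneousComponent_of_mem hx, if_pos rfl]

variable (R) in
/-- The ideal of polynomials none of whose monomials divides the monomial with exponent `β`. -/
def nonDivisorIdeal (β : σ →₀ ℕ) : Ideal (MvPolynomial σ R) where
  carrier := {p | ∀ γ ≤ β, coeff γ p = 0}
  zero_mem' := fun γ _ => coeff_zero γ
  add_mem' := fun {p q} hp hq γ h => by rw [coeff_add, hp γ h, hq γ h, add_zero]
  smul_mem' := fun p q hq γ h => by
    classical
    rw [smul_eq_mul, coeff_mul]
    refine Finset.sum_eq_zero fun x hx => ?_
    rw [hq x.2 (le_trans (Finset.HasAntidiagonal.mem_antidiagonal.1 hx ▸ le_add_self) h),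
      mul_zero]

theorem map_mem_ideal {J : Ideal (MvPolynomial σ R)}
    (T : (A →₀ MvPolynomial σ R) →ₗ[MvPolynomial σ R] MvPolynomial σ R)
    (hT : ∀ a, T (Finsupp.single a 1) ∈ J) (y : A →₀ MvPolynomial σ R) : T y ∈ J := by
  rw [map_eq_sum_mul]
  exact J.sum_mem fun a _ => J.mul_mem_left _ (hT a)

theorem mem_nonDivisorIdeal_of_isHomogeneous {β : σ →₀ ℕ} {q : MvPolynomial σ R} {m : ℕ}
    (hq : q.IsHomogeneous m) (hm : β.degree ≠ m)
    (h : ∀ γ ≤ β, γ.degree < β.degree → q ∈ nonDivisorIdeal R γ) :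
    q ∈ nonDivisorIdeal R β := by
  intro γ hγ
  rcases (Finsupp.degree_mono hγ).lt_or_eq with hlt | heq
  · exact h γ hγ hlt γ le_rfl
  · exact hq.coeff_eq_zero (heq ▸ hm)

end GradedFree

/-- `SumOfEdges E k w` says that the exponent vector `w` is the sum of `k` edges of `E`. -/
inductive SumOfEdges {n : ℕ} (E : Fin n → Fin n → Prop) : ℕ → (Fin n →₀ ℕ) → Prop
  | zero : SumOfEdges E 0 0
  | add_edge {k : ℕ} {w : Fin n →₀ ℕ} {a b : Fin n} : SumOfEdges E k w → E a b →
      SumOfEdges E (k + 1) (w + (Finsupp.single a 1 + Finsupp.single b 1))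

namespace SumOfEdges

variable {n : ℕ} {E : Fin n → Fin n → Prop} {k : ℕ} {w : Fin n →₀ ℕ}

theorem degree_eq (h : SumOfEdges E k w) : w.degree = 2 * k := by
  induction h with
  | zero => simp
  | add_edge _ _ ih =>
    simp only [map_add, ih, Finsupp.degree_single]
    omega

theorem nsmul {a b : Fin n} (hab : E a b) (k : ℕ) :
    SumOfEdges E k (k • (Finsupp.single a 1 + Finsupp.single b 1)) := by
  induction k with
  | zero =>
    rw [zero_smul]
    exact .zero
  | succ k ih =>
    rw [succ_nsmul]
    exact ih.add_edge hab

end SumOfEdges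

theorem edgeIdeal_pow_eq_span (K : Type) [Field K] {n : ℕ} (E : Fin n → Fin n → Prop) (k : ℕ) :
    edgeIdeal K E ^ k =
      Ideal.span ((fun w => monomial w (1 : K)) '' {w | SumOfEdges E k w}) := by
  induction k with
  | zero =>
    rw [pow_zero, Ideal.one_eq_top, eq_comm, Ideal.eq_top_iff_one]
    exact Ideal.subset_span ⟨0, .zero, rfl⟩
  | succ k ih =>
    rw [pow_succ, ih, edgeIdeal, Ideal.span_mul_span']
    congr 1
    ext p
    constructor
    · rintro ⟨_, ⟨w, hw, rfl⟩, _, ⟨a, b, hab, rfl⟩, rfl⟩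
      exact ⟨_, hw.add_edge hab, by simp [X, monomial_mul]⟩
    · rintro ⟨_, h, rfl⟩
      cases h with
      | @add_edge _ w a b hw hab =>
        exact ⟨_, ⟨w, hw, rfl⟩, _, ⟨a, b, hab, rfl⟩, by simp [X, monomial_mul]⟩

theorem SumOfEdges.of_mem_minGen {K : Type} [Field K] {n : ℕ} {E : Fin n → Fin n → Prop}
    {k : ℕ} {w : Fin n →₀ ℕ} (h : w ∈ minGen (edgeIdeal K E ^ k)) : SumOfEdges E k w := by
  classical
  obtain ⟨hw, hmin⟩ := h
  rw [edgeIdeal_pow_eq_span] at hw hmin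
  obtain ⟨s, hs, hle⟩ := mem_ideal_span_monomial_image.1 hw w (by simp [mem_support_iff])
  by_cases hsw : s = w
  · exact hsw ▸ hs
  · exact (hmin s hle hsw (Ideal.subset_span ⟨s, hs, rfl⟩)).elim

section Gap

variable {n : ℕ} {E : Fin n → Fin n → Prop} {i i' j j' : Fin n} {k : ℕ}

theorem degree_eq_of_support_subset (h1 : i ≠ i') (h2 : i ≠ j) (h3 : i ≠ j') (h4 : i' ≠ j)
    (h5 : i' ≠ j') (h6 : j ≠ j') {e : Fin n →₀ ℕ} (he : e.support ⊆ {i, i', j, j'}) :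
    e.degree = e i + e i' + e j + e j' := by
  rw [Finsupp.degree_apply, Finset.sum_subset he fun x _ hx => Finsupp.notMem_support_iff.1 hx]
  rw [Finset.sum_insert (by simp [h1, h2, h3]), Finset.sum_insert (by simp [h4, h5]),
    Finset.sum_pair h6]
  ring

theorem SumOfEdges.even_of_support_subset (hsymm : ∀ i j, E i j → E j i)
    (h1 : i ≠ i') (h2 : i ≠ j) (h3 : i ≠ j') (h4 : i' ≠ j) (h5 : i' ≠ j')
    (g1 : ¬ E i j) (g2 : ¬ E i j') (g3 : ¬ E i' j) (g4 : ¬ E i' j')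
    {w : Fin n →₀ ℕ} (hw : SumOfEdges E k w) (hs : w.support ⊆ {i, i', j, j'}) :
    Even (w i + w i') := by
  induction hw with
  | zero => simp
  | @add_edge k w a b hw hab ih =>
    have mem (x : Fin n) (hx : (w + (Finsupp.single a 1 + Finsupp.single b 1) : Fin n →₀ ℕ) x ≠ 0) :
        x = i ∨ x = i' ∨ x = j ∨ x = j' := by
      simpa using hs (Finsupp.mem_support_iff.2 hx)
    have hev := ih fun x hx => by
      simpa using mem x (by
        rw [Finsupp.add_apply]
        exact (Nat.add_pos_left (Nat.pos_of_ne_zero (Finsupp.mem_support_iff.1 hx)) _).ne')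
    have ha := mem a (by simp)
    have hb := mem b (by simp)
    have hba := hsymm a b hab
    simp only [Finsupp.add_apply, Finsupp.single_apply]
    rcases ha with rfl | rfl | rfl | rfl <;> rcases hb with rfl | rfl | rfl | rfl <;>
      first
      | exact absurd hab ‹_›
      | exact absurd hba ‹_›
      | grind

/-- Two sums of `k` edges dividing a common monomial of degree at most `2k+1` that is supported
on a gap have the same degree along the first edge of the gap. -/
theorem SumOfEdges.apply_add_apply_eq (hsymm : ∀ i j, E i j → E j i)
    (h1 : i ≠ i') (h2 : i ≠ j) (h3 : i ≠ j') (h4 : i' ≠ j) (h5 : i' ≠ j') (h6 : j ≠ j')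
    (g1 : ¬ E i j) (g2 : ¬ E i j') (g3 : ¬ E i' j) (g4 : ¬ E i' j')
    {w w' β : Fin n →₀ ℕ} (hw : SumOfEdges E k w) (hw' : SumOfEdges E k w')
    (hβ : β.support ⊆ {i, i', j, j'}) (hdeg : β.degree ≤ 2 * k + 1)
    (hle : w ≤ β) (hle' : w' ≤ β) : w i + w i' = w' i + w' i' := by
  have hs := (Finsupp.support_mono hle).trans hβ
  have hs' := (Finsupp.support_mono hle').trans hβ
  have ev := hw.even_of_support_subset hsymm h1 h2 h3 h4 h5 g1 g2 g3 g4 hs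
  have ev' := hw'.even_of_support_subset hsymm h1 h2 h3 h4 h5 g1 g2 g3 g4 hs'
  have d := degree_eq_of_support_subset h1 h2 h3 h4 h5 h6 hs
  have d' := degree_eq_of_support_subset h1 h2 h3 h4 h5 h6 hs'
  have dβ := degree_eq_of_support_subset h1 h2 h3 h4 h5 h6 hβ
  rw [hw.degree_eq] at d
  rw [hw'.degree_eq] at d'
  have := hle i; have := hle i'; have := hle j; have := hle j'
  have := hle' i; have := hle' i'; have := hle' j; have := hle' j'
  grind

end Gap

/-- If all first syzygies of `I` in degree `d + 1` come from lower degrees, then vanishing of a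
functional on syzygies propagates from degree `d` to degree `d + 1`. Here `ε` presents `I` by
generators of degree `c ≤ d`. -/
theorem map_mem_nonDivisorIdeal_of_partialRes {K : Type} [Field K] {n : ℕ}
    {I : Ideal (SRing K n)} {A : Type*} {c d : ℕ} (hcd : c ≤ d)
    (ε Λ : (A →₀ SRing K n) →ₗ[SRing K n] SRing K n)
    (hε : ∀ a, (ε (Finsupp.single a 1)).IsHomogeneous c)
    (hΛ : ∀ a, (Λ (Finsupp.single a 1)).IsHomogeneous c)
    (hI : LinearMap.range ε = I)
    {r : ℕ∞} (hr : 0 < r) (R : GradedPartialRes I r) (hR : ∀ l, R.dg 1 l ≠ d + 1)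
    {β : Fin n →₀ ℕ} (hβ : β.degree = d + 1)
    (ih : ∀ γ ≤ β, γ.degree ≤ d → ∀ z, ε z = 0 → Λ z ∈ nonDivisorIdeal K γ)
    (z : A →₀ SRing K n) (hz : ε z = 0) : Λ z ∈ nonDivisorIdeal K β := by
  have hψ (l) : ∃ y, IsHomogeneousVec (fun _ : A => c) (R.dg 0 l) y ∧
      ε y = R.aug (Finsupp.single l 1) :=
    exists_isHomogeneousVec_map_eq ε hε (R.aug_hom l)
      (hI.trans R.aug_range.symm ▸ LinearMap.mem_range_self _ _)
  choose f hf hεf using hψ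
  have hφ (a) : ∃ y, IsHomogeneousVec (R.dg 0) c y ∧ R.aug y = ε (Finsupp.single a 1) :=
    exists_isHomogeneousVec_map_eq R.aug R.aug_hom (hε a)
      (R.aug_range.trans hI.symm ▸ LinearMap.mem_range_self _ _)
  choose g hg haug using hφ
  set ψ := Finsupp.linearCombination (SRing K n) f with ψ_def
  set φ := Finsupp.linearCombination (SRing K n) g with φ_def
  have hεψ : ε ∘ₗ ψ = R.aug := by
    ext l
    simp [ψ_def, hεf]
  have haugφ : R.aug ∘ₗ φ = ε := by
    ext a
    simp [φ_def, haug]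
  have hΛψ (l) : ((Λ ∘ₗ ψ) (Finsupp.single l 1)).IsHomogeneous (R.dg 0 l) := by
    simpa [ψ_def] using isHomogeneous_map Λ hΛ (hf l)
  have hexact := R.exact_zero hr
  have haugdiff (y) : R.aug (R.diff 0 y) = 0 :=
    LinearMap.mem_ker.1 (hexact ▸ LinearMap.mem_range_self _ _)
  have hlow (x) (hx : ε x = 0) {m : ℕ} (hm : (Λ x).IsHomogeneous m) (hmd : m ≠ d + 1) :
      Λ x ∈ nonDivisorIdeal K β :=
    mem_nonDivisorIdeal_of_isHomogeneous hm (hβ ▸ hmd.symm)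
      fun γ hγ hlt => ih γ hγ (by omega) x hx
  have hdiff (y) : (Λ ∘ₗ ψ ∘ₗ R.diff 0) y ∈ nonDivisorIdeal K β := by
    refine map_mem_ideal (Λ ∘ₗ ψ ∘ₗ R.diff 0)
      (fun l => hlow (ψ (R.diff 0 (Finsupp.single l 1))) ?_ (m := R.dg 1 l) ?_ (hR l)) y
    · change (ε ∘ₗ ψ) (R.diff 0 (Finsupp.single l 1)) = 0
      rw [hεψ, haugdiff]
    · exact isHomogeneous_map (Λ ∘ₗ ψ) hΛψ (R.diff_hom 0 l)
  have hsub : (Λ ∘ₗ (LinearMap.id - ψ ∘ₗ φ)) z ∈ nonDivisorIdeal K β := by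
    refine map_mem_ideal (Λ ∘ₗ (LinearMap.id - ψ ∘ₗ φ))
      (fun a => hlow (Finsupp.single a 1 - ψ (φ (Finsupp.single a 1))) ?_ (m := c) ?_ (by omega)) z
    · have h : ε ∘ₗ (LinearMap.id - ψ ∘ₗ φ) = 0 := by
        rw [LinearMap.comp_sub, ← LinearMap.comp_assoc, hεψ, haugφ, LinearMap.comp_id, sub_self]
      exact LinearMap.congr_fun h _
    · rw [map_sub]
      refine (hΛ a).sub ?_
      have h := isHomogeneous_map (Λ ∘ₗ ψ) hΛψ (hg a)
      simpa [φ_def] using h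
  have hker : φ z ∈ LinearMap.range (R.diff 0) := by
    rw [hexact, LinearMap.mem_ker]
    exact (LinearMap.congr_fun haugφ z).trans hz
  obtain ⟨y, hy⟩ := hker
  have hsum := add_mem hsub (hdiff y)
  simpa [hy] using hsum

theorem exists_partialRes_of_gradedBetti_eq_zero {K : Type} [Field K] {n : ℕ}
    {I : Ideal (SRing K n)} {p q : ℕ} (h : gradedBetti I p q = 0) :
    ∃ R : GradedPartialRes I ((p : ℕ∞) + 1), ∀ l, R.dg p l ≠ q := by
  obtain ⟨R, hR⟩ := ENat.iInf_eq_zero.1 h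
  refine ⟨R, fun l hl => ?_⟩
  rw [Nat.cast_eq_zero, Finset.card_eq_zero] at hR
  exact Finset.notMem_empty l (hR ▸ Finset.mem_filter.2 ⟨Finset.mem_univ l, hl⟩)

/-- A linearly related ideal generated in degree `c`: a functional whose values on syzygies are
controlled in degrees at most `c + 1` is controlled in all degrees. -/
theorem LinearlyRelated.map_mem_nonDivisorIdeal {K : Type} [Field K] {n : ℕ}
    {I : Ideal (SRing K n)} {A : Type*} {c : ℕ} (hlin : LinearlyRelated I c)
    (ε Λ : (A →₀ SRing K n) →ₗ[SRing K n] SRing K n)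
    (hε : ∀ a, (ε (Finsupp.single a 1)).IsHomogeneous c)
    (hΛ : ∀ a, (Λ (Finsupp.single a 1)).IsHomogeneous c)
    (hI : LinearMap.range ε = I) {α : Fin n →₀ ℕ}
    (h : ∀ β ≤ α, β.degree ≤ c + 1 → ∀ z, ε z = 0 → Λ z ∈ nonDivisorIdeal K β)
    {z : A →₀ SRing K n} (hz : ε z = 0) : Λ z ∈ nonDivisorIdeal K α := by
  suffices H : ∀ d, ∀ β ≤ α, β.degree ≤ d → ∀ z, ε z = 0 → Λ z ∈ nonDivisorIdeal K β from
    H _ α le_rfl le_rfl z hz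
  intro d
  induction d with
  | zero => exact fun β hβ hd => h β hβ (by omega)
  | succ d ih =>
    intro β hβ hd
    by_cases hc : β.degree ≤ c + 1
    · exact h β hβ hc
    by_cases hlt : β.degree ≤ d
    · exact ih β hβ hlt
    obtain ⟨R, hR⟩ := exists_partialRes_of_gradedBetti_eq_zero (hlin 1 le_rfl d (by omega))
    exact map_mem_nonDivisorIdeal_of_partialRes (d := d) (by omega) ε Λ hε hΛ hI (by simp) R
      (fun l => add_comm 1 d ▸ hR l) (by omega)
      fun γ hγ hγd => ih γ (hγ.trans hβ) hγd

/-- If the graph `G` (possibly with loops) has a gap `{i,i'}, {j,j'}`, then for every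
`k ≥ 1` the monomials `u = (x_i x_{i'})^k` and `v = (x_j x_{j'})^k` are not connected in
`G_{I^k}^{(u,v)}`; consequently `I^k` is not linearly related for any `k ≥ 1`. -/
theorem stmt3 (K : Type) [Field K] (n : ℕ) (E : Fin n → Fin n → Prop)
    (hsymm : ∀ i j, E i j → E j i)
    (i i' j j' : Fin n)
    (h1 : i ≠ i') (h2 : i ≠ j) (h3 : i ≠ j') (h4 : i' ≠ j) (h5 : i' ≠ j') (h6 : j ≠ j')
    (hii' : E i i') (hjj' : E j j')
    (g1 : ¬ E i j) (g2 : ¬ E i j') (g3 : ¬ E i' j) (g4 : ¬ E i' j') :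
    ∀ k : ℕ, 1 ≤ k →
      (¬ Relation.ReflTransGen
          (lcmGraphAdj ((edgeIdeal K E) ^ k) (2*k)
            (k • (Finsupp.single i 1 + Finsupp.single i' 1))
            (k • (Finsupp.single j 1 + Finsupp.single j' 1)))
          (k • (Finsupp.single i 1 + Finsupp.single i' 1))
          (k • (Finsupp.single j 1 + Finsupp.single j' 1))) ∧
      ¬ LinearlyRelated ((edgeIdeal K E) ^ k) (2*k) := by
  intro k hk
  set u : Fin n →₀ ℕ := k • (Finsupp.single i 1 + Finsupp.single i' 1) with hu_def
  set v : Fin n →₀ ℕ := k • (Finsupp.single j 1 + Finsupp.single j' 1) with hv_def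
  have hu : SumOfEdges E k u := .nsmul hii' k
  have hv : SumOfEdges E k v := .nsmul hjj' k
  have hui : u i + u i' = 2 * k := by
    simp [hu_def, h1, h1.symm]
    omega
  have hvi : v i + v i' = 0 := by
    simp [hv_def, h2, h3, h4, h5]
  have hsupp : (u + v).support ⊆ {i, i', j, j'} := by
    intro x hx
    by_contra hx'
    simp only [Finset.mem_insert, Finset.mem_singleton, not_or] at hx'
    simp [hu_def, hv_def, hx'] at hx
  constructor
  · intro hpath
    have inv (w) (hw : Relation.ReflTransGen (lcmGraphAdj (edgeIdeal K E ^ k) (2 * k) u v) u w) :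
        w i + w i' = 2 * k := by
      induction hw with
      | refl => exact hui
      | tail _ hadj ih =>
        obtain ⟨hw, hw', hle, hle', hdeg⟩ := hadj
        rw [← ih]
        have hsub := (sup_le hle hle').trans
          (sup_le le_self_add le_add_self)
        exact (SumOfEdges.of_mem_minGen hw').apply_add_apply_eq hsymm h1 h2 h3 h4 h5 h6
          g1 g2 g3 g4 (.of_mem_minGen hw) ((Finsupp.support_mono hsub).trans hsupp)
          (le_of_eq hdeg) le_sup_right le_sup_left
    have := inv v hpath
    omega
  · intro hlin
    classical
    let A := {w : Fin n →₀ ℕ // SumOfEdges E k w}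
    let ε : (A →₀ SRing K n) →ₗ[SRing K n] SRing K n :=
      Finsupp.linearCombination _ fun w => monomial w.1 1
    let Λ : (A →₀ SRing K n) →ₗ[SRing K n] SRing K n :=
      Finsupp.linearCombination _ fun w => if w.1 i + w.1 i' = 2 * k then monomial w.1 1 else 0
    have hε_single (w : A) : ε (Finsupp.single w 1) = monomial w.1 1 := by simp [ε]
    have hΛ_single (w : A) : Λ (Finsupp.single w 1) =
        if w.1 i + w.1 i' = 2 * k then monomial w.1 1 else 0 := by simp [Λ]
    have hmem (β : Fin n →₀ ℕ) (w : A) (h : ¬ w.1 ≤ β) :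
        monomial w.1 (1 : K) ∈ nonDivisorIdeal K β := by
      intro γ hγ
      rw [coeff_monomial, if_neg]
      rintro rfl
      exact h hγ
    let z : A →₀ SRing K n :=
      Finsupp.single ⟨u, hu⟩ (monomial v 1) - Finsupp.single ⟨v, hv⟩ (monomial u 1)
    have hz : ε z = 0 := by
      simp [ε, z, monomial_mul, add_comm]
    have hΛz : Λ z = monomial (u + v) 1 := by
      have hk0 : 0 ≠ 2 * k := by omega
      simp [Λ, z, monomial_mul, hui, hvi, hk0, add_comm]
    have key : Λ z ∈ nonDivisorIdeal K (u + v) := by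
      refine hlin.map_mem_nonDivisorIdeal ε Λ (fun w => ?_) (fun w => ?_) ?_ ?_ hz
      · rw [hε_single]
        exact isHomogeneous_monomial _ w.2.degree_eq
      · rw [hΛ_single]
        split_ifs
        · exact isHomogeneous_monomial _ w.2.degree_eq
        · exact isHomogeneous_zero _ _ _
      · rw [edgeIdeal_pow_eq_span, Finsupp.range_linearCombination, Ideal.span, Set.image_eq_range]
        rfl
      · intro β hβ hdeg y hy
        have hβs := (Finsupp.support_mono hβ).trans hsupp
        by_cases hA : ∃ w : A, w.1 ≤ β ∧ w.1 i + w.1 i' = 2 * k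
        · obtain ⟨w₀, hw₀, hw₀k⟩ := hA
          have hsub : (Λ - ε) y ∈ nonDivisorIdeal K β := by
            refine map_mem_ideal _ (fun w => ?_) y
            rw [LinearMap.sub_apply, hε_single, hΛ_single]
            by_cases hw : w.1 ≤ β
            · rw [if_pos, sub_self]
              · exact zero_mem _
              · rw [← hw₀k]
                exact w.2.apply_add_apply_eq hsymm h1 h2 h3 h4 h5 h6 g1 g2 g3 g4 w₀.2
                  hβs hdeg hw hw₀
            · split_ifs
              · rw [sub_self]
                exact zero_mem _
              · exact sub_mem (zero_mem _) (hmem β w hw)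
          rwa [LinearMap.sub_apply, hy, sub_zero] at hsub
        · refine map_mem_ideal _ (fun w => ?_) y
          rw [hΛ_single]
          split_ifs with hwk
          · exact hmem β w fun hw => hA ⟨w, hw, hwk⟩
          · exact zero_mem _
    have := key (u + v) le_rfl
    rw [hΛz, coeff_monomial, if_pos rfl] at this
    exact one_ne_zero this

end
end
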